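/- Let S and R be noetherian local rings with R regular local and S regular local, let φ : S → R be a local ring homomorphism, and assume the Krull dimensions satisfy dim S = dim R. Let M be a nonzero finitely generated R-module which, regarded as an S-module via φ, is finite free over S. Then M is a free R-module. -/

import Mathlib

/-- A regular local ring: a noetherian local ring whose maximal ideal can be generated
by `dim R` elements (where `dim R` is the Krull dimension). -/
def IsRegularLocal (R : Type*) [CommRing R] [IsLocalRing R] : Prop :=
  IsNoetherianRing R ∧
    ∃ s : Finset R, Ideal.span (s : Set R) = IsLocalRing.maximalIdeal R ∧
      (s.card : WithBot (WithTop ℕ)) = ringKrullDim R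

open IsLocalRing RingTheory.Sequence
open scoped Pointwise

universe u v

namespace IsRegularLocalRing

/-- The maximal ideal of the quotient of a local ring by an element `x ∈ 𝔪 \ 𝔪²` needs fewer
generators. -/
lemma spanFinrank_maximalIdeal_quotient_add_one_le {R : Type u} [CommRing R] [IsLocalRing R]
    [IsNoetherianRing R] {x : R} [IsLocalRing (R ⧸ Ideal.span {x})] (hx : x ∈ maximalIdeal R)
    (hx2 : x ∉ maximalIdeal R ^ 2) :
    (maximalIdeal (R ⧸ Ideal.span {x})).spanFinrank + 1 ≤ (maximalIdeal R).spanFinrank := by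
  classical
  obtain ⟨s, hcard, hs⟩ :=
    Submodule.FG.exists_span_finset_card_eq_spanFinrank (maximalIdeal R).fg_of_isNoetherianRing
  have hsub (y : R) (hy : y ∈ s) : y ∈ maximalIdeal R := hs ▸ Submodule.subset_span hy
  have hx' : x ∈ Submodule.span R (s : Set R) := hs ▸ hx
  obtain ⟨a, -, ha⟩ := Submodule.mem_span_finset.mp hx'
  obtain ⟨y, hy, hay⟩ : ∃ y ∈ s, a y ∉ maximalIdeal R := by
    by_contra! h
    refine hx2 (ha ▸ Ideal.sum_mem _ fun y hy ↦ ?_)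
    rw [pow_two]
    exact Ideal.mul_mem_mul (h y hy) (hsub y hy)
  have hunit : IsUnit (a y) := by simpa using hay
  set f := Ideal.Quotient.mk (Ideal.span {x})
  have hf : Function.Surjective f := Ideal.Quotient.mk_surjective
  have hfx : f x = 0 := Ideal.Quotient.eq_zero_iff_mem.mpr (Ideal.mem_span_singleton_self x)
  have hmax : maximalIdeal (R ⧸ Ideal.span {x}) =
      Submodule.span _ (((s.erase y).image f : Finset _) : Set (R ⧸ Ideal.span {x})) := by
    have hmap : maximalIdeal (R ⧸ Ideal.span {x}) = (maximalIdeal R).map f :=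
      (map_maximalIdeal_of_surjective f hf).symm
    refine le_antisymm ?_ (Submodule.span_le.mpr ?_)
    · have hgen : maximalIdeal R = Ideal.span (s : Set R) := hs.symm
      rw [hmap, hgen, Ideal.map_span, Ideal.span_le]
      have hmem (z : R) (hz : z ∈ s.erase y) : f z ∈
          Submodule.span (R ⧸ Ideal.span {x}) (((s.erase y).image f : Finset _) : Set _) :=
        Submodule.subset_span (by
          rw [Finset.coe_image]; exact Set.mem_image_of_mem _ hz)
      rintro _ ⟨z, hz, rfl⟩
      by_cases hzy : z = y
      · subst hzy
        have hsum : f (a z) * f z = - ∑ w ∈ s.erase z, f (a w) * f w := by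
          rw [← Finset.add_sum_erase _ _ hy] at ha
          have := congrArg f ha
          simp only [smul_eq_mul, map_add, map_mul, map_sum, hfx] at this
          exact eq_neg_of_add_eq_zero_left this
        refine (Ideal.unit_mul_mem_iff_mem _ (hunit.map f)).mp ?_
        rw [hsum]
        exact neg_mem (Ideal.sum_mem _ fun w hw ↦ Ideal.mul_mem_left _ _ (hmem w hw))
      · exact hmem z (Finset.mem_erase.mpr ⟨hzy, hz⟩)
    · rw [Finset.coe_image]
      rintro _ ⟨z, hz, rfl⟩
      rw [hmap]
      exact Ideal.mem_map_of_mem f (hsub z (Finset.mem_of_mem_erase hz))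
  have hle : (maximalIdeal (R ⧸ Ideal.span {x})).spanFinrank ≤ (s.erase y).card := by
    rw [hmax]
    refine (Submodule.spanFinrank_span_le_ncard_of_finite (Finset.finite_toSet _)).trans ?_
    rw [Set.ncard_coe_finset]
    exact Finset.card_image_le
  have := Finset.card_erase_add_one hy
  omega

lemma quotient_span_singleton {R : Type u} [CommRing R] [IsRegularLocalRing R] {n : ℕ}
    (hdim : ringKrullDim R = (n + 1 : ℕ)) {x : R} (hx : x ∈ maximalIdeal R)
    (hx2 : x ∉ maximalIdeal R ^ 2) :
    IsRegularLocalRing (R ⧸ Ideal.span {x}) ∧ ringKrullDim (R ⧸ Ideal.span {x}) = n := by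
  have : Nontrivial (R ⧸ Ideal.span {x}) := Ideal.Quotient.nontrivial_iff.mpr fun h ↦
    (maximalIdeal.isMaximal R).ne_top <| top_le_iff.mp <|
      h ▸ (Ideal.span_singleton_le_iff_mem _).mpr hx
  have : IsLocalRing (R ⧸ Ideal.span {x}) :=
    .of_surjective' (Ideal.Quotient.mk _) Ideal.Quotient.mk_surjective
  have h1 := spanFinrank_maximalIdeal_quotient_add_one_le hx hx2
  have h2 : (maximalIdeal R).spanFinrank = n + 1 := by
    have := (isRegularLocalRing_iff R).mp ‹_›
    rw [hdim] at this
    exact_mod_cast this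
  have h3 : (n : WithBot ℕ∞) ≤ ringKrullDim (R ⧸ Ideal.span {x}) := by
    have h := ringKrullDim_le_ringKrullDim_quotSMulTop_succ hx
    have e : x • (⊤ : Ideal R) = Ideal.span {x} := by
      simp [← Submodule.ideal_span_singleton_smul]
    rw [e, hdim] at h
    push_cast at h
    exact (ENat.WithBot.add_le_add_one_right_iff).mp h
  have h4 : ((maximalIdeal (R ⧸ Ideal.span {x})).spanFinrank : WithBot ℕ∞) ≤ n := by
    exact_mod_cast (by omega : (maximalIdeal (R ⧸ Ideal.span {x})).spanFinrank ≤ n)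
  exact ⟨of_spanFinrank_maximalIdeal_le _ (h4.trans h3),
    le_antisymm ((ringKrullDim_le_spanFinrank_maximalIdeal _).trans h4) h3⟩

/-- Prime avoidance in a regular local ring of positive dimension. -/
lemma exists_mem_maximalIdeal_notMem_sq {R : Type u} [CommRing R] [IsRegularLocalRing R] {n : ℕ}
    (hdim : ringKrullDim R = (n + 1 : ℕ)) {P : Set (Ideal R)} (hP : P.Finite)
    (hprime : ∀ p ∈ P, p.IsPrime) (hle : ∀ p ∈ P, ¬ maximalIdeal R ≤ p) :
    ∃ x ∈ maximalIdeal R, x ∉ maximalIdeal R ^ 2 ∧ ∀ p ∈ P, x ∉ p := by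
  by_contra! h
  have hsub : (maximalIdeal R : Set R) ⊆ ⋃ p ∈ insert (maximalIdeal R ^ 2) P, (p : Set R) := by
    intro x hx
    by_cases hx2 : x ∈ maximalIdeal R ^ 2
    · exact Set.mem_biUnion (Set.mem_insert _ _) hx2
    · obtain ⟨p, hp, hxp⟩ := h x hx hx2
      exact Set.mem_biUnion (Set.mem_insert_of_mem _ hp) hxp
  replace hsub := (Ideal.subset_union_prime_finite (hP.insert _) (f := id) (maximalIdeal R ^ 2)
    (maximalIdeal R ^ 2) fun p hp hne _ ↦ hprime p (hp.resolve_left hne)).mp hsub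
  obtain ⟨p, rfl | hp, hmp⟩ := hsub
  · have hbot : maximalIdeal R = ⊥ :=
      Submodule.eq_bot_of_le_smul_of_le_jacobson_bot (maximalIdeal R) _
        (maximalIdeal R).fg_of_isNoetherianRing (by simpa [pow_two] using hmp)
        (maximalIdeal_le_jacobson _)
    have := (isRegularLocalRing_iff R).mp ‹_›
    rw [hdim, hbot, Submodule.spanFinrank_bot] at this
    norm_cast at this
  · exact hle p hp hmp

theorem isDomain_of_ringKrullDim_eq (n : ℕ) {R : Type u} [CommRing R] [IsRegularLocalRing R]
    (hdim : ringKrullDim R = n) : IsDomain R := by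
  induction n generalizing R with
  | zero =>
    have h := (isRegularLocalRing_iff R).mp ‹_›
    rw [hdim, Nat.cast_inj,
      Submodule.spanFinrank_eq_zero_iff_eq_bot (maximalIdeal R).fg_of_isNoetherianRing] at h
    exact (isField_iff_maximalIdeal_eq.mpr h).isDomain
  | succ n ih =>
    obtain ⟨x, hx, hx2, hxp⟩ := exists_mem_maximalIdeal_notMem_sq hdim
      (minimalPrimes.finite_of_isNoetherianRing R) (fun p hp ↦ hp.1.1) fun p hp hle ↦ by
        have := hp.1.1
        have heq : p = maximalIdeal R := le_antisymm (le_maximalIdeal this.ne_top) hle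
        have h0 := Ideal.height_eq_zero_iff.mpr hp
        rw [heq] at h0
        have := maximalIdeal_height_eq_ringKrullDim (R := R)
        rw [h0, hdim] at this
        norm_cast at this
    obtain ⟨hreg, hdim'⟩ := quotient_span_singleton hdim hx hx2
    have := ih hdim'
    have hxprime : (Ideal.span {x}).IsPrime := (Ideal.Quotient.isDomain_iff_prime _).mp this
    obtain ⟨p, hp, hpx⟩ := Ideal.exists_minimalPrimes_le (bot_le (a := Ideal.span {x}))
    have hpp : p.IsPrime := hp.1.1
    have hbot : p = ⊥ := by
      refine Submodule.eq_bot_of_le_smul_of_le_jacobson_bot (maximalIdeal R) _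
        p.fg_of_isNoetherianRing (fun y hy ↦ ?_) (maximalIdeal_le_jacobson _)
      obtain ⟨z, rfl⟩ := Ideal.mem_span_singleton'.mp (hpx hy)
      rw [mul_comm]
      exact Submodule.smul_mem_smul hx ((hpp.mem_or_mem hy).resolve_right (hxp p hp))
    have : (⊥ : Ideal R).IsPrime := hbot ▸ hpp
    exact IsDomain.of_bot_isPrime R

/-- A nonzero finite free module over a regular local ring has a regular sequence of length the
dimension of the ring. -/
theorem exists_isRegular_of_free (n : ℕ) {S : Type u} [CommRing S] [IsRegularLocalRing S]
    (hdim : ringKrullDim S = n) (M : Type v) [AddCommGroup M] [Module S M] [Nontrivial M]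
    [Module.Finite S M] [Module.Free S M] :
    ∃ rs : List S, rs.length = n ∧ (∀ r ∈ rs, r ∈ maximalIdeal S) ∧ IsRegular M rs := by
  induction n generalizing S M with
  | zero => exact ⟨[], rfl, by simp, .nil S M⟩
  | succ n ih =>
    have := isDomain_of_ringKrullDim_eq _ hdim
    obtain ⟨x, hx, hx2, -⟩ :=
      exists_mem_maximalIdeal_notMem_sq hdim Set.finite_empty (by simp) (by simp)
    obtain ⟨_, hdim'⟩ := quotient_span_singleton hdim hx hx2
    have hreg : IsSMulRegular M x :=
      Module.Flat.isSMulRegular_of_nonZeroDivisors <| mem_nonZeroDivisors_of_ne_zero <| by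
        rintro rfl; exact hx2 (zero_mem _)
    have := nontrivial_quotSMulTop_of_mem_maximalIdeal M hx
    have := Module.Finite.of_restrictScalars_finite S (S ⧸ Ideal.span {x}) (QuotSMulTop x M)
    obtain ⟨rs, hlen, hmem, hrs⟩ := ih hdim' (QuotSMulTop x M)
    obtain ⟨rs, rfl⟩ := List.map_surjective_iff.mpr
      (Ideal.Quotient.mk_surjective (I := Ideal.span {x})) rs
    refine ⟨x :: rs, by simpa using hlen, ?_, .cons' hreg hrs⟩
    simp only [List.mem_cons, forall_eq_or_imp]
    refine ⟨hx, fun r hr ↦ ?_⟩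
    have := hmem _ (List.mem_map_of_mem hr)
    rw [mem_maximalIdeal] at this ⊢
    exact fun h ↦ this (h.map _)

end IsRegularLocalRing

section Depth

open CategoryTheory Abelian Limits

/-- Quotienting by a regular element lowers the depth by at most one. -/
lemma exists_isRegular_quotSMulTop {R : Type u} [CommRing R] [Small.{v} R] [IsLocalRing R]
    [IsNoetherianRing R] (M : Type v) [AddCommGroup M] [Module R M] [Nontrivial M]
    [Module.Finite R M] {n : ℕ} {rs : List R} (hlen : rs.length = n + 1)
    (hmem : ∀ r ∈ rs, r ∈ maximalIdeal R) (hrs : IsRegular M rs) {x : R}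
    (hx : x ∈ maximalIdeal R) (hreg : IsSMulRegular M x) :
    ∃ rs' : List R, rs'.length = n ∧ (∀ r ∈ rs', r ∈ maximalIdeal R) ∧
      IsRegular (QuotSMulTop x M) rs' := by
  have smul_lt (N : Type v) [AddCommGroup N] [Module R N] [Nontrivial N] [Module.Finite R N] :
      maximalIdeal R • (⊤ : Submodule R N) < ⊤ :=
    (Submodule.top_ne_ideal_smul_of_le_jacobson_annihilator
      (maximalIdeal_le_jacobson _)).symm.lt_top
  have := nontrivial_quotSMulTop_of_mem_maximalIdeal M hx
  have hiff := (ModuleCat.exists_isRegular_tfae (maximalIdeal R) (n + 1) (ModuleCat.of R M)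
    (smul_lt M)).out 3 1
  have hext := hiff.mp ⟨rs, hlen, hmem, hrs⟩
  refine ((ModuleCat.exists_isRegular_tfae (maximalIdeal R) n
    (ModuleCat.of R (QuotSMulTop x M)) (smul_lt _)).out 1 3).mp fun i hi ↦ ?_
  have hzero := AddCommGrpCat.isZero_of_iff_subsingleton.mpr (hext i (by omega))
  have hzero' := AddCommGrpCat.isZero_of_iff_subsingleton.mpr (hext (i + 1) (by omega))
  have hreg' : IsSMulRegular (ModuleCat.of R M) x := hreg
  exact AddCommGrpCat.subsingleton_of_isZero <| ShortComplex.Exact.isZero_of_both_zeros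
    ((Ext.covariant_sequence_exact₃' _ hreg'.smulShortComplex_shortExact) i (i + 1) rfl)
    (hzero.eq_zero_of_src _) (hzero'.eq_zero_of_tgt _)

end Depth

/-- A finite module over a regular local ring whose depth is at least the dimension of the ring is
free. -/
theorem IsRegularLocalRing.free_of_isRegular (n : ℕ) {R : Type u} [CommRing R] [Small.{v} R]
    [IsRegularLocalRing R] (hdim : ringKrullDim R = n) (M : Type v) [AddCommGroup M] [Module R M]
    [Nontrivial M] [Module.Finite R M] {rs : List R} (hlen : rs.length = n)
    (hmem : ∀ r ∈ rs, r ∈ maximalIdeal R) (hrs : IsRegular M rs) : Module.Free R M := by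
  induction n generalizing R M with
  | zero =>
    have h := (isRegularLocalRing_iff R).mp ‹_›
    rw [hdim, Nat.cast_inj,
      Submodule.spanFinrank_eq_zero_iff_eq_bot (maximalIdeal R).fg_of_isNoetherianRing] at h
    let := (isField_iff_maximalIdeal_eq.mpr h).toField
    exact Module.Free.of_divisionRing R M
  | succ n ih =>
    obtain ⟨x, hx, hx2, hxp⟩ := exists_mem_maximalIdeal_notMem_sq hdim
      (associatedPrimes.finite R M) (fun p hp ↦ hp.isPrime) fun p hp hle ↦ by
        match rs, hlen with
        | r :: rs, _ =>
          have hr : r ∈ ⋃ p ∈ associatedPrimes R M, (p : Set R) :=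
            Set.mem_biUnion hp (hle (hmem r (by simp)))
          rw [biUnion_associatedPrimes_eq_compl_regular] at hr
          exact hr ((isRegular_cons_iff M r rs).mp hrs).1
    have hreg : IsSMulRegular M x := by
      by_contra h
      have hx' : x ∈ ({r : R | IsSMulRegular M r}ᶜ : Set R) := h
      rw [← biUnion_associatedPrimes_eq_compl_regular, Set.mem_iUnion₂] at hx'
      obtain ⟨p, hp, hxp'⟩ := hx'
      exact hxp p hp hxp'
    obtain ⟨_, hdim'⟩ := quotient_span_singleton hdim hx hx2
    obtain ⟨rs', hlen', hmem', hrs'⟩ := exists_isRegular_quotSMulTop M hlen hmem hrs hx hreg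
    have := nontrivial_quotSMulTop_of_mem_maximalIdeal M hx
    have := Module.Finite.of_restrictScalars_finite R (R ⧸ Ideal.span {x}) (QuotSMulTop x M)
    have : Small.{v} (R ⧸ Ideal.span {x}) := small_of_surjective Ideal.Quotient.mk_surjective
    have hjac : x ∈ (⊥ : Ideal R).jacobson := maximalIdeal_le_jacobson _ hx
    have : Module.FinitePresentation R M := Module.finitePresentation_of_finite R M
    refine (Module.free_quotSMulTop_iff_free R M hjac hreg).mp <|
      ih hdim' (QuotSMulTop x M) (rs := rs'.map (Ideal.Quotient.mk _)) (by simpa using hlen') ?_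
        ((isRegular_cons_iff' M x rs').mp ((isRegular_cons_iff M x rs').mpr ⟨hreg, hrs'⟩)).2
    intro r hr
    obtain ⟨r, hr', rfl⟩ := List.mem_map.mp hr
    have hloc : IsLocalHom (Ideal.Quotient.mk (Ideal.span {x})) :=
      .of_surjective _ Ideal.Quotient.mk_surjective
    exact map_nonunit _ r (hmem' r hr')

lemma IsRegularLocal.isRegularLocalRing {R : Type*} [CommRing R] [IsLocalRing R]
    (h : IsRegularLocal R) : IsRegularLocalRing R := by
  obtain ⟨_, s, hs, hcard⟩ := h
  refine .of_spanFinrank_maximalIdeal_le R ?_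
  rw [← hcard, ← hs]
  have := Submodule.spanFinrank_span_le_ncard_of_finite (R := R) s.finite_toSet
  rw [Set.ncard_coe_finset] at this
  exact Nat.cast_le.mpr this

/-- Let `S` and `R` be regular (noetherian) local rings, `φ : S → R` a
local ring homomorphism, and assume `dim S = dim R`.  Let `M` be a nonzero finitely
generated `R`-module which, viewed as an `S`-module via `φ`, is finite free.  Then `M`
is a free `R`-module. -/
theorem free_of_free_over_regular_base
    (S R : Type*) [CommRing S] [CommRing R] [IsLocalRing S] [IsLocalRing R]
    (hS : IsRegularLocal S) (hR : IsRegularLocal R)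
    (φ : S →+* R) (hφ : IsLocalHom φ)
    (hdim : ringKrullDim S = ringKrullDim R)
    (M : Type*) [AddCommGroup M] [Module R M] [Nontrivial M] [Module.Finite R M]
    [Module S M] (hcompat : ∀ (s : S) (m : M), s • m = φ s • m)
    [Module.Finite S M] [Module.Free S M] :
    Module.Free R M := by
  have := hS.isRegularLocalRing
  have := hR.isRegularLocalRing
  obtain ⟨n, hn⟩ : ∃ n : ℕ, ringKrullDim R = n := ⟨_, (isRegularLocalRing_iff R).mp this |>.symm⟩
  obtain ⟨rs, hlen, hmem, hrs⟩ :=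
    IsRegularLocalRing.exists_isRegular_of_free n (hdim.trans hn) M
  have hrs' : IsRegular (ULift.{u_2} M) (rs.map φ) :=
    (AddEquiv.isRegular_congr (e := AddEquiv.ulift.symm) <| List.forall₂_map_right_iff.mpr <|
      List.forall₂_same.mpr fun s _ m ↦ congrArg ULift.up (hcompat s m)).mp hrs
  have : Module.Free R (ULift.{u_2} M) :=
    IsRegularLocalRing.free_of_isRegular n hn _ (by simpa using hlen) (fun r hr ↦ by
      obtain ⟨s, hs, rfl⟩ := List.mem_map.mp hr
      exact map_nonunit φ s (hmem s hs)) hrs'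
  exact Module.Free.of_equiv ULift.moduleEquiv
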